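/- arXiv:math/0209333 — 2 statements merged into one kernel-verified Lean document; each statement's English description precedes it below -/
import Mathlib

section
/- Let p be an odd prime, let k ≥ 1, and let a and b be integers coprime to p. Then the orthogonal direct sum (ℤ/p^kℤ, q_a) ⊕ (ℤ/p^kℤ, q_a) is isometric to the orthogonal direct sum (ℤ/p^kℤ, q_b) ⊕ (ℤ/p^kℤ, q_b). -/
open scoped BigOperators

noncomputable section

/-- The group `ℚ/ℤ`. -/
abbrev QmodZ : Type := ℚ ⧸ AddSubgroup.zmultiples (1 : ℚ)

/-- The group `ℚ/2ℤ`. -/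
abbrev Qmod2Z : Type := ℚ ⧸ AddSubgroup.zmultiples (2 : ℚ)

/-- The isomorphism `ℚ/2ℤ → ℚ/ℤ` induced by dividing by `2`. -/
noncomputable def halfHom : Qmod2Z →+ QmodZ :=
  QuotientAddGroup.map _ _ (AddMonoidHom.mk' (fun x : ℚ => x / 2) (fun a b => add_div a b 2))
    (by
      intro x hx
      obtain ⟨k, rfl⟩ := AddSubgroup.mem_zmultiples_iff.mp hx
      refine AddSubgroup.mem_zmultiples_iff.mpr ⟨k, ?_⟩
      show k • (1:ℚ) = (k • (2:ℚ)) / 2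
      push_cast [zsmul_eq_mul]
      ring)

/-- The bilinear form `b(x,y) = (q(x+y) - q(x) - q(y))/2 ∈ ℚ/ℤ` associated to
`q : A → ℚ/2ℤ`. -/
def bForm {A : Type*} [AddCommGroup A] (q : A → Qmod2Z) (x y : A) : QmodZ :=
  halfHom (q (x + y) - q x - q y)

/-- `q : A → ℚ/2ℤ` is a finite quadratic space structure on the finite abelian group `A`
if the associated form `b` is `ℤ`-bilinear (i.e. biadditive) and nondegenerate. -/
structure IsFiniteQuadraticSpace {A : Type*} [AddCommGroup A] [Finite A]
    (q : A → Qmod2Z) : Prop where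
  add_left : ∀ x x' y, bForm q (x + x') y = bForm q x y + bForm q x' y
  add_right : ∀ x y y', bForm q x (y + y') = bForm q x y + bForm q x y'
  nondeg : ∀ x, (∀ y, bForm q x y = 0) → x = 0

/-- Two quadratic forms are isometric if some group isomorphism carries one to the other. -/
def FQSIsometric {A B : Type*} [AddCommGroup A] [AddCommGroup B]
    (qA : A → Qmod2Z) (qB : B → Qmod2Z) : Prop :=
  ∃ e : A ≃+ B, ∀ x, qB (e x) = qA x

/-- An even lattice, given by its rank and Gram matrix: the Gram matrix is symmetric,
has even diagonal (so `(x,x)` is always even) and is nondegenerate. -/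
structure EvenLattice : Type where
  n : ℕ
  B : Matrix (Fin n) (Fin n) ℤ
  symm : B.IsSymm
  even_diag : ∀ i, 2 ∣ B i i
  nondeg : B.det ≠ 0

/-- The bilinear form of `L` extended to `R^n` for any commutative ring `R ⊇ ℤ`. -/
def formR (L : EvenLattice) (R : Type*) [CommRing R] (x y : Fin L.n → R) : R :=
  ∑ i, ∑ j, (L.B i j : R) * x i * y j

theorem formR_zero_left (L : EvenLattice) (R : Type*) [CommRing R] (y : Fin L.n → R) :
    formR L R 0 y = 0 := by
  simp [formR]

theorem formR_add_left (L : EvenLattice) (R : Type*) [CommRing R] (x x' y : Fin L.n → R) :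
    formR L R (x + x') y = formR L R x y + formR L R x' y := by
  simp [formR, mul_add, add_mul, Finset.sum_add_distrib]

theorem formR_neg_left (L : EvenLattice) (R : Type*) [CommRing R] (x y : Fin L.n → R) :
    formR L R (-x) y = -formR L R x y := by
  simp [formR, Finset.sum_neg_distrib]

/-- `L` and `M` are isometric over `R`. -/
def IsometricOver (R : Type*) [CommRing R] (L M : EvenLattice) : Prop :=
  ∃ e : (Fin L.n → R) ≃ₗ[R] (Fin M.n → R), ∀ x y, formR M R (e x) (e y) = formR L R x y

/-- `L` and `M` lie in the same genus: they are isometric over `ℤ_p` for all primes `p`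
and over `ℝ`. -/
def SameGenus (L M : EvenLattice) : Prop :=
  (∀ (p : ℕ) [Fact p.Prime], IsometricOver ℤ_[p] L M) ∧ IsometricOver ℝ L M

/-- The subgroup of integral vectors in `ℚ^n`, i.e. the lattice `L` itself inside `L ⊗ ℚ`. -/
def intSub (L : EvenLattice) : AddSubgroup (Fin L.n → ℚ) where
  carrier := {x | ∀ i, ∃ m : ℤ, x i = m}
  zero_mem' := fun i => ⟨0, by simp⟩
  add_mem' := by
    intro x y hx hy i
    obtain ⟨mx, hmx⟩ := hx i
    obtain ⟨my, hmy⟩ := hy i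
    exact ⟨mx + my, by simp [hmx, hmy]⟩
  neg_mem' := by
    intro x hx i
    obtain ⟨m, hm⟩ := hx i
    exact ⟨-m, by simp [hm]⟩

/-- The dual lattice of a subgroup `K` of `L ⊗ ℚ`:
all vectors pairing integrally with every element of `K`. -/
def dualOf (L : EvenLattice) (K : AddSubgroup (Fin L.n → ℚ)) : AddSubgroup (Fin L.n → ℚ) where
  carrier := {x | ∀ y ∈ K, ∃ m : ℤ, formR L ℚ x y = m}
  zero_mem' := fun y _ => ⟨0, by simp [formR_zero_left]⟩
  add_mem' := by
    intro x x' hx hx' y hy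
    obtain ⟨m, hm⟩ := hx y hy
    obtain ⟨m', hm'⟩ := hx' y hy
    exact ⟨m + m', by rw [formR_add_left, hm, hm']; push_cast; ring⟩
  neg_mem' := by
    intro x hx y hy
    obtain ⟨m, hm⟩ := hx y hy
    exact ⟨-m, by rw [formR_neg_left, hm]; push_cast; ring⟩

/-- The dual lattice `L^*` of `L`. -/
abbrev dualSub (L : EvenLattice) : AddSubgroup (Fin L.n → ℚ) := dualOf L (intSub L)

/-- The discriminant group `K^*/K` of a subgroup `K` of `L ⊗ ℚ`. -/
abbrev discGroupOf (L : EvenLattice) (K : AddSubgroup (Fin L.n → ℚ)) : Type :=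
  dualOf L K ⧸ K.addSubgroupOf (dualOf L K)

/-- The discriminant group `L^*/L`. -/
abbrev discGroup (L : EvenLattice) : Type := discGroupOf L (intSub L)

/-- The discriminant form on `K^*/K`, `q(x + K) = (x,x) mod 2ℤ`
(defined via a choice of representative; it is independent of this choice). -/
noncomputable def discQOf (L : EvenLattice) (K : AddSubgroup (Fin L.n → ℚ)) :
    discGroupOf L K → Qmod2Z :=
  fun a => (QuotientAddGroup.mk (formR L ℚ (a.out : Fin L.n → ℚ) (a.out : Fin L.n → ℚ)) : Qmod2Z)

/-- The discriminant form `q_L` on `L^*/L`. -/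
noncomputable def discQ (L : EvenLattice) : discGroup L → Qmod2Z := discQOf L (intSub L)

/-- `n₊`: the maximal dimension of a positive definite subspace of `L ⊗ ℝ`. -/
noncomputable def sigPlus (L : EvenLattice) : ℕ :=
  sSup {d : ℕ | ∃ W : Submodule ℝ (Fin L.n → ℝ), Module.finrank ℝ W = d ∧
    ∀ x ∈ W, x ≠ 0 → 0 < formR L ℝ x x}

/-- `n₋`: the maximal dimension of a negative definite subspace of `L ⊗ ℝ`. -/
noncomputable def sigMinus (L : EvenLattice) : ℕ :=
  sSup {d : ℕ | ∃ W : Submodule ℝ (Fin L.n → ℝ), Module.finrank ℝ W = d ∧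
    ∀ x ∈ W, x ≠ 0 → formR L ℝ x x < 0}

end

/-- The standard quadratic form `q_a` on `ℤ/p^kℤ` sending (the class of) `x` to
`2·a·x²/p^k mod 2ℤ`. -/
def stdQ (p k : ℕ) (a : ℤ) : ZMod (p ^ k) → Qmod2Z :=
  fun x => (QuotientAddGroup.mk ((2 * (a : ℚ) * (x.val : ℚ) ^ 2) / (p ^ k : ℚ)) : Qmod2Z)

theorem aux_mk_eq (p k : ℕ) (hp : p.Prime) (m m' : ℤ)
    (h : (m : ZMod (p ^ k)) = (m' : ZMod (p ^ k))) :
    (QuotientAddGroup.mk ((2 * (m : ℚ)) / (p ^ k : ℚ)) : Qmod2Z) =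
      QuotientAddGroup.mk ((2 * (m' : ℚ)) / (p ^ k : ℚ)) := by
  rw [ZMod.intCast_eq_intCast_iff_dvd_sub] at h
  obtain ⟨t, ht⟩ := h
  rw [QuotientAddGroup.eq]
  refine AddSubgroup.mem_zmultiples_iff.mpr ⟨t, ?_⟩
  have hp0 : (p : ℚ) ≠ 0 := by exact_mod_cast hp.ne_zero
  have ht' : (m' : ℚ) - m = (p : ℚ) ^ k * t := by exact_mod_cast ht
  have hm : (m' : ℚ) = m + (p : ℚ) ^ k * t := by linarith
  rw [hm, zsmul_eq_mul]
  field_simp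
  ring

theorem aux_lift (p : ℕ) (hp : p.Prime) (hodd : p ≠ 2) (u : ℤ) (hu : ¬ (p : ℤ) ∣ u) (n : ℕ) :
    ∃ c d : ℤ, ¬ (p : ℤ) ∣ c ∧ (p : ℤ) ^ (n + 1) ∣ c ^ 2 + d ^ 2 - u := by
  have hpp : Prime (p : ℤ) := Nat.prime_iff_prime_int.mp hp
  induction n with
  | zero =>
    have : Fact p.Prime := ⟨hp⟩
    obtain ⟨x, y, hxy⟩ := ZMod.sq_add_sq p (u : ZMod p)
    obtain ⟨c, rfl⟩ := ZMod.intCast_surjective x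
    obtain ⟨d, rfl⟩ := ZMod.intCast_surjective y
    have h : (p : ℤ) ∣ c ^ 2 + d ^ 2 - u := by
      rw [← ZMod.intCast_zmod_eq_zero_iff_dvd]
      push_cast
      rw [hxy, sub_self]
    by_cases hc : (p : ℤ) ∣ c
    · refine ⟨d, c, fun hd => hu ?_, by simpa [add_comm] using h⟩
      have h2 : (p : ℤ) ∣ c ^ 2 + d ^ 2 :=
        dvd_add (dvd_pow hc two_ne_zero) (dvd_pow hd two_ne_zero)
      simpa using dvd_sub h2 h
    · exact ⟨c, d, hc, by simpa using h⟩
  | succ n ih =>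
    obtain ⟨c, d, hc, e, he⟩ := ih
    have h2 : ¬ (p : ℤ) ∣ 2 := by
      intro h
      have : p ∣ 2 := by exact_mod_cast h
      exact hodd ((Nat.prime_dvd_prime_iff_eq hp Nat.prime_two).mp this)
    have h2c : ¬ (p : ℤ) ∣ 2 * c := fun h => (hpp.dvd_or_dvd h).elim h2 hc
    obtain ⟨r, s, hrs⟩ := (hpp.coprime_iff_not_dvd.mpr h2c)
    refine ⟨c + (-e * s) * p ^ (n + 1), d, ?_, ?_⟩
    · intro h
      apply hc
      have : (p : ℤ) ∣ (-e * s) * p ^ (n + 1) := Dvd.dvd.mul_left (dvd_pow_self _ (by omega)) _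
      simpa using dvd_sub h this
    · refine ⟨e * r + (e * s) ^ 2 * p ^ n, ?_⟩
      linear_combination he - e * p ^ (n + 1) * hrs

theorem aux_sum (p k : ℕ) (hp : p.Prime) (a b : ℤ) (x y z w : ZMod (p ^ k))
    (h : (a : ZMod (p ^ k)) * (x ^ 2 + y ^ 2) = b * (z ^ 2 + w ^ 2)) :
    stdQ p k a x + stdQ p k a y = stdQ p k b z + stdQ p k b w := by
  have : NeZero (p ^ k) := ⟨pow_ne_zero _ hp.ne_zero⟩
  have key : ∀ (a : ℤ) (x y : ZMod (p ^ k)), stdQ p k a x + stdQ p k a y =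
      QuotientAddGroup.mk
        ((2 * ((a * ((x.val : ℤ) ^ 2 + (y.val : ℤ) ^ 2) : ℤ) : ℚ)) / (p ^ k : ℚ)) := by
    intro a x y
    unfold stdQ
    rw [← QuotientAddGroup.mk_add]
    congr 1
    push_cast
    ring
  rw [key, key]
  apply aux_mk_eq p k hp
  push_cast
  simpa using h

/-- **Relation among the generators at odd primes.**
For an odd prime `p`, `k ≥ 1`, and `a`, `b` coprime to `p`, the orthogonal direct sum
`(ℤ/p^kℤ, q_a) ⊕ (ℤ/p^kℤ, q_a)` is isometric to `(ℤ/p^kℤ, q_b) ⊕ (ℤ/p^kℤ, q_b)`. -/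
theorem odd_primary_doubling_relation
    (p : ℕ) (hp : p.Prime) (hodd : p ≠ 2) (k : ℕ) (hk : 1 ≤ k)
    (a b : ℤ) (ha : IsCoprime a (p : ℤ)) (hb : IsCoprime b (p : ℤ)) :
    FQSIsometric
      (fun x : ZMod (p ^ k) × ZMod (p ^ k) => stdQ p k a x.1 + stdQ p k a x.2)
      (fun x : ZMod (p ^ k) × ZMod (p ^ k) => stdQ p k b x.1 + stdQ p k b x.2) := by
  have hpp : Prime (p : ℤ) := Nat.prime_iff_prime_int.mp hp
  obtain ⟨r, s, hrs⟩ : IsCoprime b ((p : ℤ) ^ k) := hb.pow_right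
  obtain ⟨r', s', hrs'⟩ : IsCoprime a ((p : ℤ) ^ k) := ha.pow_right
  obtain ⟨n, rfl⟩ : ∃ n, k = n + 1 := ⟨k - 1, by omega⟩
  have hu : ¬ (p : ℤ) ∣ r * a := by
    intro h
    have hpn : (p : ℤ) ∣ p ^ (n + 1) := dvd_pow_self _ (by omega)
    rcases hpp.dvd_or_dvd h with h | h
    · exact hpp.not_dvd_one (hrs ▸ dvd_add (h.mul_right _) (hpn.mul_left _))
    · exact hpp.not_dvd_one (hrs' ▸ dvd_add (h.mul_left _) (hpn.mul_left _))
  obtain ⟨c, d, -, hcd⟩ := aux_lift p hp hodd (r * a) hu n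
  have h0 : ((p : ZMod (p ^ (n + 1)))) ^ (n + 1) = 0 := by
    exact_mod_cast ZMod.natCast_self (p ^ (n + 1))
  have h1 : (r : ZMod (p ^ (n + 1))) * b = 1 := by
    have := congrArg (Int.cast : ℤ → ZMod (p ^ (n + 1))) hrs
    push_cast at this
    rwa [h0, mul_zero, add_zero] at this
  have h2 : (r' : ZMod (p ^ (n + 1))) * a = 1 := by
    have := congrArg (Int.cast : ℤ → ZMod (p ^ (n + 1))) hrs'
    push_cast at this
    rwa [h0, mul_zero, add_zero] at this
  have h3 : (c : ZMod (p ^ (n + 1))) ^ 2 + d ^ 2 = r * a := by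
    obtain ⟨t, ht⟩ := hcd
    have := congrArg (Int.cast : ℤ → ZMod (p ^ (n + 1))) ht
    push_cast at this
    rw [h0, zero_mul] at this
    exact sub_eq_zero.mp this
  generalize (c : ZMod (p ^ (n + 1))) = C at h3
  generalize (d : ZMod (p ^ (n + 1))) = D at h3
  have h4 : (b * r' : ZMod (p ^ (n + 1))) * (C ^ 2 + D ^ 2) = 1 := by
    rw [h3]
    linear_combination r' * a * h1 + h2
  generalize (b * r' : ZMod (p ^ (n + 1))) = v at h4
  refine ⟨{ toFun := fun x => (C * x.1 - D * x.2, D * x.1 + C * x.2)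
            invFun := fun x => (v * (C * x.1 + D * x.2), v * (C * x.2 - D * x.1))
            left_inv := ?_
            right_inv := ?_
            map_add' := ?_ }, ?_⟩
  · rintro ⟨x, y⟩
    ext
    · linear_combination x * h4
    · linear_combination y * h4
  · rintro ⟨x, y⟩
    ext
    · linear_combination x * h4
    · linear_combination y * h4
  · rintro ⟨x, y⟩ ⟨x', y'⟩
    ext
    · simp only [Prod.fst_add, Prod.snd_add]; ring
    · simp only [Prod.fst_add, Prod.snd_add]; ring
  · rintro ⟨x, y⟩
    apply aux_sum _ _ hp
    show (b : ZMod (p ^ (n + 1))) * ((C * x - D * y) ^ 2 + (D * x + C * y) ^ 2) = a * (x ^ 2 + y ^ 2)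
    linear_combination b * (x ^ 2 + y ^ 2) * h3 + a * (x ^ 2 + y ^ 2) * h1
end

section
/- Let L and M be even lattices. If the discriminant forms (L*/L, q_L) and (M*/M, q_M) are isometric as finite quadratic spaces and L and M have equal signatures, then L and M lie in the same genus, i.e., for every prime p the quadratic modules L⊗ℤ_p and M⊗ℤ_p over the p-adic integers ℤ_p are isometric, and L⊗ℝ and M⊗ℝ are isometric. -/
open scoped BigOperators

section NkAll
open QuadraticMap

section PartA
variable {R : Type*} [CommRing R] {V W : Type*} [AddCommGroup V] [Module R V]
  [AddCommGroup W] [Module R W]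

/-- orthogonal complement of a pair -/
def nkPerp (Q : QuadraticForm R V) (e f : V) : Submodule R V :=
  LinearMap.ker (Q.polarBilin e) ⊓ LinearMap.ker (Q.polarBilin f)

theorem mem_nkPerp {Q : QuadraticForm R V} {e f x : V} :
    x ∈ nkPerp Q e f ↔ polar Q e x = 0 ∧ polar Q f x = 0 := by
  simp [nkPerp]

structure NkPair (Q : QuadraticForm R V) (e f : V) : Prop where
  he : Q e = 0
  hf : Q f = 0
  hef : polar Q e f = 1

theorem NkPair.symm {Q : QuadraticForm R V} {e f : V} (h : NkPair Q e f) : NkPair Q f e :=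
  ⟨h.hf, h.he, by rw [polar_comm]; exact h.hef⟩

theorem nk_map_add (Q : QuadraticForm R V) (x y : V) : Q (x + y) = Q x + Q y + polar Q x y := by
  simp [polar]

theorem nk_polar_self0 {Q : QuadraticForm R V} {e : V} (h : Q e = 0) : polar Q e e = 0 := by
  rw [polar_self, h, smul_zero]

theorem nk_equiv_of_maps {Q : QuadraticForm R V} {Q' : QuadraticForm R W} (g : V →ₗ[R] W)
    (k : W → V) (h1 : ∀ x, k (g x) = x) (h2 : ∀ y, g (k y) = y) (h : ∀ x, Q' (g x) = Q x) :
    Q.Equivalent Q' :=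
  ⟨⟨{ g with invFun := k, left_inv := h1, right_inv := h2 }, h⟩⟩

theorem nk_equiv_of_eq {Q : QuadraticForm R V} {S T : Submodule R V} (h : S = T) :
    (Q.restrict S).Equivalent (Q.restrict T) := by
  subst h; exact Equivalent.refl _

theorem nkPerp_same {Q : QuadraticForm R V} {e f f' : V} (h : NkPair Q e f) (h' : NkPair Q e f') :
    (Q.restrict (nkPerp Q e f)).Equivalent (Q.restrict (nkPerp Q e f')) := by
  have key : ∀ {f f' : V}, NkPair Q e f → NkPair Q e f' → ∀ x ∈ nkPerp Q e f,
      x - polar Q f' x • e ∈ nkPerp Q e f' := by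
    intro f f' h h' x hx
    rw [mem_nkPerp] at hx ⊢
    simp [sub_eq_add_neg, polar_add_right, polar_neg_right, polar_smul_right, hx.1,
      nk_polar_self0 h.he, h'.symm.hef]
  refine nk_equiv_of_maps
      (LinearMap.codRestrict _ ((LinearMap.id - (LinearMap.toSpanSingleton R V e).comp
        (Q.polarBilin f')).comp (Submodule.subtype _)) ?_)
      (fun x => ⟨x.1 - polar Q f x.1 • e, key h' h x.1 x.2⟩) ?_ ?_ ?_
  · rintro ⟨x, hx⟩; simpa using key h h' x hx
  · rintro ⟨x, hx⟩
    rw [mem_nkPerp] at hx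
    simp [sub_eq_add_neg, polar_add_right, polar_neg_right, polar_smul_right, hx.2, h.symm.hef]
  · rintro ⟨x, hx⟩
    rw [mem_nkPerp] at hx
    ext
    simp [polar_add_right, polar_neg_right, polar_smul_right, hx.2, h'.symm.hef]
  · rintro ⟨x, hx⟩
    rw [mem_nkPerp] at hx
    simp [sub_eq_add_neg, nk_map_add, h.he, polar_neg_right, polar_smul_right, QuadraticMap.map_neg,
      QuadraticMap.map_smul, polar_comm Q x e, hx.1]

theorem nkPerp_symm {Q : QuadraticForm R V} {e f : V} : nkPerp Q e f = nkPerp Q f e := by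
  simp [nkPerp, inf_comm]

theorem NkPair.of_unit {Q : QuadraticForm R V} {e f : V} (he : Q e = 0) (hf : Q f = 0) (u : Rˣ)
    (h : polar Q e f = u) : NkPair Q e ((↑u⁻¹ : R) • f) :=
  ⟨he, by simp [QuadraticMap.map_smul, hf], by simp [polar_smul_right, h]⟩

theorem nkPerp_smul_right {Q : QuadraticForm R V} {e f : V} (u : Rˣ) :
    nkPerp Q e ((u : R) • f) = nkPerp Q e f := by
  ext x; simp [mem_nkPerp, polar_smul_left]

theorem nkPerp_step {Q : QuadraticForm R V} {e f e' f' : V} (h : NkPair Q e f)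
    (h' : NkPair Q e' f') (hu : IsUnit (polar Q e e')) :
    (Q.restrict (nkPerp Q e f)).Equivalent (Q.restrict (nkPerp Q e' f')) := by
  obtain ⟨u, hu⟩ := hu
  have h1 := NkPair.of_unit h.he h'.he u hu.symm
  have h2 := NkPair.of_unit h'.he h.he u (by rw [polar_comm]; exact hu.symm)
  refine (nkPerp_same h h1).trans (Equivalent.trans (nk_equiv_of_eq ?_) (nkPerp_same h2 h'))
  rw [nkPerp_smul_right, nkPerp_symm, nkPerp_smul_right]

theorem nk_unit_one_add [IsLocalRing R] {x : R} (h : ¬ IsUnit x) : IsUnit (1 + x) := by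
  by_contra h2
  have := IsLocalRing.nonunits_add (a := 1 + x) (b := -x) h2 (by simpa using h)
  simp at this

theorem nkPerp_equiv [IsLocalRing R] {Q : QuadraticForm R V} {e f e' f' : V} (h : NkPair Q e f)
    (h' : NkPair Q e' f') :
    (Q.restrict (nkPerp Q e f)).Equivalent (Q.restrict (nkPerp Q e' f')) := by
  by_cases h1 : IsUnit (polar Q e e')
  · exact nkPerp_step h h' h1
  by_cases h2 : IsUnit (polar Q f e')
  · rw [nkPerp_symm]; exact nkPerp_step h.symm h' h2
  by_cases h3 : IsUnit (polar Q e f')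
  · rw [nkPerp_symm (e := e')]; exact nkPerp_step h h'.symm h3
  obtain ⟨v, hv⟩ := nk_unit_one_add h3
  set t : R := -(polar Q f f') * (↑v⁻¹ : R) with ht
  set g : V := f + f' + t • e with hg
  have hQg : Q g = 0 := by
    rw [hg, nk_map_add, nk_map_add, QuadraticMap.map_smul, h.he, h.hf, h'.hf, polar_smul_right,
      polar_add_left, h.symm.hef, polar_comm Q f' e, ← hv, ht]
    simp
  have hge : polar Q e g = 1 + polar Q e f' := by
    rw [hg, polar_add_right, polar_add_right, polar_smul_right, h.hef, nk_polar_self0 h.he]; simp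
  have hu : IsUnit (polar Q e g) := by rw [hge]; exact nk_unit_one_add h3
  have hu' : IsUnit (polar Q g e') := by
    have : polar Q g e' = 1 + (polar Q f e' + t * polar Q e e') := by
      rw [hg, polar_add_left, polar_add_left, polar_smul_left, h'.symm.hef, smul_eq_mul]; ring
    rw [this]
    apply nk_unit_one_add
    exact IsLocalRing.nonunits_add h2 (fun hh => h1 (isUnit_of_mul_isUnit_right hh))
  obtain ⟨u, hu2⟩ := hu
  have hp := NkPair.of_unit hQg h.he u (by rw [polar_comm]; exact hu2.symm)
  exact (nkPerp_step h hp ⟨u, hu2⟩).trans (nkPerp_step hp h' hu')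

/-- the hyperbolic plane -/
def nkH (R : Type*) [CommRing R] : QuadraticForm R (R × R) :=
  QuadraticMap.linMulLin (LinearMap.fst R R R) (LinearMap.snd R R R)

theorem nkH_apply (x : R × R) : nkH R x = x.1 * x.2 := rfl

theorem nkPerp_map {Q : QuadraticForm R V} {Q' : QuadraticForm R W} (g : Q.IsometryEquiv Q')
    (e f : V) :
    (Q.restrict (nkPerp Q e f)).Equivalent (Q'.restrict (nkPerp Q' (g e) (g f))) := by
  have hp : ∀ x y, polar Q' (g x) (g y) = polar Q x y := by
    intro x y; simp [polar, ← map_add]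
  refine nk_equiv_of_maps
      (LinearMap.codRestrict _ (g.toLinearEquiv.toLinearMap.comp (Submodule.subtype _)) ?_)
      (fun x => ⟨g.symm x.1, ?_⟩) ?_ ?_ ?_
  · rintro ⟨x, hx⟩
    rw [mem_nkPerp] at hx ⊢
    simpa [hp] using hx
  · have := x.2
    rw [mem_nkPerp] at this ⊢
    rw [← hp, ← hp]
    simpa using this
  · rintro ⟨x, hx⟩; ext; simp
  · rintro ⟨x, hx⟩; ext; simp
  · rintro ⟨x, hx⟩; simp

theorem nkH_pair (Q : QuadraticForm R V) :
    NkPair ((nkH R).prod Q) ((1, 0), 0) ((0, 1), 0) :=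
  ⟨by simp [nkH_apply], by simp [nkH_apply], by simp [polar, nkH_apply]⟩

theorem nkH_perp (Q : QuadraticForm R V) :
    Q.Equivalent (((nkH R).prod Q).restrict (nkPerp ((nkH R).prod Q) ((1, 0), 0) ((0, 1), 0))) := by
  refine nk_equiv_of_maps
      (LinearMap.codRestrict _ (LinearMap.inr R (R × R) V) ?_)
      (fun x => x.1.2) ?_ ?_ ?_
  · intro x; rw [mem_nkPerp]; simp [polar, nkH_apply]
  · intro x; simp
  · rintro ⟨⟨⟨a, b⟩, x⟩, hx⟩
    rw [mem_nkPerp] at hx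
    simp [polar, nkH_apply] at hx
    have ha : a = 0 := by linear_combination hx.2
    have hb : b = 0 := by linear_combination hx.1
    subst ha hb
    rfl
  · intro x; simp

theorem nk_cancel [IsLocalRing R] {Q : QuadraticForm R V} {Q' : QuadraticForm R W}
    (h : ((nkH R).prod Q).Equivalent ((nkH R).prod Q')) : Q.Equivalent Q' := by
  obtain ⟨g⟩ := h
  refine (nkH_perp Q).trans (((nkPerp_map g _ _).trans ?_).trans (nkH_perp Q').symm)
  have hp : ∀ x y, polar ((nkH R).prod Q') (g x) (g y) = polar ((nkH R).prod Q) x y := by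
    intro x y
    simp only [polar, ← map_add, g.map_app]
  have h1 := nkH_pair (R := R) Q
  refine nkPerp_equiv ⟨?_, ?_, ?_⟩ (nkH_pair Q')
  · rw [g.map_app]; exact h1.he
  · rw [g.map_app]; exact h1.hf
  · rw [hp]; exact h1.hef

theorem nk_split {Q : QuadraticForm R V} {e f : V} (h : NkPair Q e f) :
    ((nkH R).prod (Q.restrict (nkPerp Q e f))).Equivalent Q := by
  refine nk_equiv_of_maps
    (LinearMap.coprod (LinearMap.coprod (LinearMap.toSpanSingleton R V e)
      (LinearMap.toSpanSingleton R V f)) (Submodule.subtype _))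
    (fun x => ((polar Q f x, polar Q e x), ⟨x - polar Q f x • e - polar Q e x • f, ?_⟩)) ?_ ?_ ?_
  · rw [mem_nkPerp]
    simp [sub_eq_add_neg, polar_add_right, polar_neg_right, polar_smul_right, 
      h.symm.hef, h.hef, nk_polar_self0 h.he, nk_polar_self0 h.hf]
  · rintro ⟨⟨a, b⟩, ⟨x, hx⟩⟩
    rw [mem_nkPerp] at hx
    simp [polar_add_right, polar_neg_right, polar_smul_right, hx, 
      h.symm.hef, h.hef, nk_polar_self0 h.he, nk_polar_self0 h.hf]
    abel
  · intro x
    simp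
  · rintro ⟨⟨a, b⟩, ⟨x, hx⟩⟩
    rw [mem_nkPerp] at hx
    simp [nk_map_add, nkH_apply, polar_add_left, polar_smul_left, polar_smul_right, hx, 
      h.he, h.hf, h.hef, QuadraticMap.map_smul, mul_comm]

/-- the sum of hyperbolic planes -/
def nkHn (R : Type*) [CommRing R] (n : ℕ) : QuadraticForm R (Fin n → R × R) :=
  QuadraticMap.pi (fun _ => nkH R)

theorem nkHn_apply (n : ℕ) (x : Fin n → R × R) : nkHn R n x = ∑ i, (x i).1 * (x i).2 := by
  simp [nkHn, nkH_apply]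

theorem nkHn_succ (n : ℕ) : ((nkH R).prod (nkHn R n)).Equivalent (nkHn R (n + 1)) := by
  refine nk_equiv_of_maps
    { toFun := fun x => Fin.cons x.1 x.2
      map_add' := ?_
      map_smul' := ?_ } (fun x => (x 0, Fin.tail x)) ?_ ?_ ?_
  · intro x y; ext i <;> refine Fin.cases ?_ (fun i => ?_) i <;> simp
  · intro c x; ext i <;> refine Fin.cases ?_ (fun i => ?_) i <;> simp
  · intro x; simp
  · intro x; simp
  · intro x; simp [nkHn_apply, nkH_apply, Fin.sum_univ_succ]

theorem nk_prodAssoc {V₁ V₂ V₃ : Type*} [AddCommGroup V₁] [Module R V₁]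
    [AddCommGroup V₂] [Module R V₂] [AddCommGroup V₃] [Module R V₃]
    (Q₁ : QuadraticForm R V₁) (Q₂ : QuadraticForm R V₂) (Q₃ : QuadraticForm R V₃) :
    ((Q₁.prod Q₂).prod Q₃).Equivalent (Q₁.prod (Q₂.prod Q₃)) :=
  ⟨⟨LinearEquiv.prodAssoc R V₁ V₂ V₃, by intro x; simp [add_assoc]⟩⟩

theorem nkHn_zero_prod (Q : QuadraticForm R V) : Q.Equivalent ((nkHn R 0).prod Q) := by
  refine nk_equiv_of_maps (LinearMap.inr R _ V) (fun x => x.2) ?_ ?_ ?_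
  · intro x; simp
  · rintro ⟨a, x⟩; simp [Subsingleton.elim a 0]
  · intro x; simp [nkHn_apply]

theorem nk_cancel_n [IsLocalRing R] (n : ℕ) {Q : QuadraticForm R V} {Q' : QuadraticForm R W}
    (h : ((nkHn R n).prod Q).Equivalent ((nkHn R n).prod Q')) : Q.Equivalent Q' := by
  induction n with
  | zero =>
    exact (nkHn_zero_prod Q).trans (h.trans (nkHn_zero_prod Q').symm)
  | succ n ih =>
    apply ih
    apply nk_cancel
    refine (nk_prodAssoc _ _ _).symm.trans (Equivalent.trans ?_ (nk_prodAssoc _ _ _))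
    exact ((nkHn_succ n).prod (Equivalent.refl _)).trans
      (h.trans ((nkHn_succ n).symm.prod (Equivalent.refl _)))
end PartA

section PartB
variable {p : ℕ} [Fact p.Prime] {V : Type*} [AddCommGroup V] [Module ℤ_[p] V]

theorem nk_toZMod_isUnit {x : ℤ_[p]} : IsUnit x ↔ PadicInt.toZMod x ≠ 0 := by
  rw [ne_eq, ← RingHom.mem_ker, PadicInt.ker_toZMod, IsLocalRing.mem_maximalIdeal, mem_nonunits_iff,
    not_not]

theorem nk_isotropic_big {ι : Type*} [Fintype ι] (b : Module.Basis ι ℤ_[p] V)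
    (Q : QuadraticForm ℤ_[p] V)
    (hun : ∀ i, ∃ w, ∀ x, polar Q w x = b.repr x i) (hc : 2 < Fintype.card ι) :
    ∃ e w, Q e = 0 ∧ IsUnit (polar Q e w) := by
  classical
  have : Module.Free ℤ_[p] V := Module.Free.of_basis b
  obtain ⟨T, hT⟩ := LinearMap.BilinMap.toQuadraticMap_surjective Q
  have hQ : ∀ x : ι → ℤ_[p], Q (∑ i, x i • b i) = ∑ i, ∑ j, T (b i) (b j) * x i * x j := by
    intro x
    rw [← hT, LinearMap.BilinMap.toQuadraticMap_apply]
    simp only [map_sum, LinearMap.sum_apply, map_smul, LinearMap.smul_apply, smul_eq_mul,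
      Finset.mul_sum]
    rw [Finset.sum_comm]
    refine Finset.sum_congr rfl fun i _ => Finset.sum_congr rfl fun j _ => by ring
  let F : MvPolynomial ι (ZMod p) := ∑ i, ∑ j, MvPolynomial.C (PadicInt.toZMod (T (b i) (b j))) *
    MvPolynomial.X i * MvPolynomial.X j
  have hdeg : F.totalDegree ≤ 2 := by
    refine MvPolynomial.totalDegree_finsetSum_le fun i _ =>
      MvPolynomial.totalDegree_finsetSum_le fun j _ => ?_
    refine (MvPolynomial.totalDegree_mul _ _).trans ?_
    have h1 := MvPolynomial.totalDegree_mul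
      (MvPolynomial.C (σ := ι) (PadicInt.toZMod (T (b i) (b j)))) (MvPolynomial.X i)
    rw [MvPolynomial.totalDegree_C, MvPolynomial.totalDegree_X] at h1
    rw [MvPolynomial.totalDegree_X]
    omega
  have hF : ∀ x : ι → ℤ_[p], MvPolynomial.eval (fun i => PadicInt.toZMod (x i)) F =
      PadicInt.toZMod (Q (∑ i, x i • b i)) := by
    intro x
    rw [hQ]
    simp [F]
  have hdvd := char_dvd_card_solutions p (f := F) (by omega)
  have h0 : MvPolynomial.eval (0 : ι → ZMod p) F = 0 := by simp [F]
  have hlt : 1 < Fintype.card { x : ι → ZMod p // MvPolynomial.eval x F = 0 } := by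
    have hpos : 0 < Fintype.card { x : ι → ZMod p // MvPolynomial.eval x F = 0 } :=
      Fintype.card_pos_iff.mpr ⟨⟨0, h0⟩⟩
    exact lt_of_lt_of_le (Fact.out : p.Prime).one_lt (Nat.le_of_dvd hpos hdvd)
  obtain ⟨⟨x, hx⟩, hne⟩ := Fintype.exists_ne_of_one_lt_card hlt ⟨0, h0⟩
  have hx0 : x ≠ 0 := fun h => hne (by simp [h])
  obtain ⟨i, hi⟩ := Function.ne_iff.mp hx0
  let y : ι → ℤ_[p] := fun i => ((x i).val : ℤ_[p])
  have hy : ∀ i, PadicInt.toZMod (y i) = x i := by intro i; simp [y]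
  set v := ∑ i, y i • b i with hv
  have hQv : PadicInt.toZMod (Q v) = 0 := by
    rw [hv, ← hF]; simp only [hy]; exact hx
  have hyi : IsUnit (y i) := by rw [nk_toZMod_isUnit, hy]; exact hi
  obtain ⟨u, hu⟩ := hyi
  obtain ⟨w', hw'⟩ := hun i
  set w := (↑u⁻¹ : ℤ_[p]) • w' with hw
  have hvw : polar Q v w = 1 := by
    rw [polar_comm, hw, polar_smul_left, hw', hv]
    have : b.repr (∑ i, y i • b i) i = y i := by
      rw [b.repr_sum_self]
    rw [this, ← hu]; simp
  let G : Polynomial ℤ_[p] := Polynomial.C (Q v) + Polynomial.X + Polynomial.C (Q w) * Polynomial.X ^ 2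
  have hG : ∀ t, G.aeval t = Q v + t + Q w * t ^ 2 := by intro t; simp [G]
  have hG' : ∀ t, G.derivative.aeval t = 1 + 2 * t * Q w := by
    intro t; simp [G]; ring
  have hnorm : ‖G.aeval (0 : ℤ_[p])‖ < ‖G.derivative.aeval (0 : ℤ_[p])‖ ^ 2 := by
    rw [hG, hG']
    have : ¬ IsUnit (Q v) := by rw [nk_toZMod_isUnit, not_not]; exact hQv
    rw [PadicInt.not_isUnit_iff] at this
    simpa using this
  obtain ⟨z, hz, -, hz', -⟩ := hensels_lemma hnorm
  rw [hG', hG'] at hz'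
  rw [hG] at hz
  refine ⟨v + z • w, w, ?_, ?_⟩
  · rw [nk_map_add, QuadraticMap.map_smul, polar_smul_right, hvw]
    simp only [smul_eq_mul]
    linear_combination hz
  · rw [PadicInt.isUnit_iff, polar_add_left, polar_smul_left, hvw, polar_self]
    simp only [smul_eq_mul, nsmul_eq_mul] at hz' ⊢
    rw [show (1 : ℤ_[p]) + z * ((2 : ℕ) * Q w) = 1 + 2 * z * Q w by push_cast; ring, hz']
    simp

theorem nk_isotropic_two (b : Module.Basis (Fin 2) ℤ_[p] V)
    (Q : QuadraticForm ℤ_[p] V)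
    (hun : ∀ i, ∃ w, ∀ x, polar Q w x = b.repr x i) (u : ℤ_[p]ˣ)
    (hdet : 4 * Q (b 0) * Q (b 1) - polar Q (b 0) (b 1) ^ 2 = - (u : ℤ_[p]) ^ 2) :
    ∃ e w, Q e = 0 ∧ IsUnit (polar Q e w) := by
  have hQ : ∀ x y : ℤ_[p], Q (x • b 0 + y • b 1) =
      x ^ 2 * Q (b 0) + y ^ 2 * Q (b 1) + x * y * polar Q (b 0) (b 1) := by
    intro x y
    rw [nk_map_add, QuadraticMap.map_smul, QuadraticMap.map_smul, polar_smul_right, polar_smul_left]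
    simp only [smul_eq_mul]; ring
  obtain ⟨w0, hw0⟩ := hun 0
  obtain ⟨w1, hw1⟩ := hun 1
  suffices h : ∃ k : ℤ_[p], Q (b 0 + k • b 1) = 0 ∨ Q (k • b 0 + b 1) = 0 by
    obtain ⟨k, h | h⟩ := h
    · exact ⟨_, w0, h, by rw [polar_comm, hw0]; simp⟩
    · exact ⟨_, w1, h, by rw [polar_comm, hw1]; simp⟩
  by_cases ha : Q (b 0) = 0
  · exact ⟨0, Or.inl (by simpa using ha)⟩
  set a := Q (b 0)
  set c := Q (b 1)
  set β := polar Q (b 0) (b 1)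
  have hy : (2 * a : ℤ_[p]) ≠ 0 := mul_ne_zero two_ne_zero ha
  rcases ValuationRing.dvd_total (u - β : ℤ_[p]) (2 * a) with ⟨k, hk⟩ | ⟨k, hk⟩
  · refine ⟨k, Or.inl ?_⟩
    have h2 := hQ 1 k
    rw [one_smul] at h2
    rw [h2]
    have hx : (u - β : ℤ_[p]) ≠ 0 := by
      intro h; rw [h, zero_mul] at hk; exact hy hk
    apply mul_left_cancel₀ (pow_ne_zero 2 hx)
    linear_combination a * hdet + (-c * ((u-β) * k + 2 * a) - (u - β) * β) * hk
  · refine ⟨k, Or.inr ?_⟩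
    have h2 := hQ k 1
    rw [one_smul] at h2
    rw [h2]
    apply mul_left_cancel₀ (pow_ne_zero 2 hy)
    linear_combination a * hdet + (-a * (2 * a * k + (u - β)) - 2 * a * β) * hk

/-- Gram matrix of the polar form -/
def nkGram {R V ι : Type*} [CommRing R] [AddCommGroup V] [Module R V] (Q : QuadraticForm R V)
    (b : ι → V) : Matrix ι ι R := Matrix.of fun i j => polar Q (b i) (b j)

theorem nk_unimod {R V ι : Type*} [CommRing R] [AddCommGroup V] [Module R V] [Fintype ι]
    [DecidableEq ι] (Q : QuadraticForm R V) (b : Module.Basis ι R V)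
    (h : IsUnit (nkGram Q b).det) (i : ι) : ∃ w, ∀ x, polar Q w x = b.repr x i := by
  refine ⟨∑ k, (nkGram Q b)⁻¹ i k • b k, fun x => ?_⟩
  have h1 := Matrix.nonsing_inv_mul _ h
  suffices h2 : Q.polarBilin (∑ k, (nkGram Q b)⁻¹ i k • b k) = b.coord i by
    have := LinearMap.congr_fun h2 x
    rwa [polarBilin_apply_apply, Module.Basis.coord_apply] at this
  refine b.ext fun j => ?_
  have h3 := congrFun (congrFun h1 i) j
  rw [Matrix.mul_apply] at h3
  simp only [nkGram, Matrix.of_apply] at h3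
  simp only [map_sum, map_smul, LinearMap.sum_apply, LinearMap.smul_apply, polarBilin_apply_apply,
    smul_eq_mul, Module.Basis.coord_apply, Module.Basis.repr_self]
  refine Eq.trans h3 ?_
  rw [Matrix.one_apply, Finsupp.single_apply]
  simp [eq_comm]

theorem nk_gram_change {R V ι : Type*} [CommRing R] [AddCommGroup V] [Module R V] [Fintype ι]
    [DecidableEq ι] (Q : QuadraticForm R V) (b c : Module.Basis ι R V) :
    ∃ u : Rˣ, (nkGram Q c).det = (nkGram Q b).det * (u : R) ^ 2 := by
  have hb : ∀ b : Module.Basis ι R V, nkGram Q b = LinearMap.BilinForm.toMatrix b Q.polarBilin := by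
    intro b; ext i j
    simp [nkGram, LinearMap.BilinForm.toMatrix_apply]
  have h := LinearMap.BilinForm.toMatrix_mul_basis_toMatrix b c Q.polarBilin
  have hu : IsUnit (b.toMatrix c).det := by
    have := b.toMatrix_mul_toMatrix_flip c
    have h2 := congrArg Matrix.det this
    rw [Matrix.det_mul, Matrix.det_one] at h2
    exact IsUnit.of_mul_eq_one _ h2
  obtain ⟨u, hu⟩ := hu
  refine ⟨u, ?_⟩
  rw [hb, hb, ← h, Matrix.det_mul, Matrix.det_mul, Matrix.det_transpose, ← hu]
  ring

theorem nk_hyperbolic (n : ℕ) : ∀ (V : Type) [AddCommGroup V] [Module ℤ_[p] V]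
    (b : Module.Basis (Fin (2 * n)) ℤ_[p] V) (Q : QuadraticForm ℤ_[p] V) (u : ℤ_[p]ˣ),
    (nkGram Q b).det = (-1) ^ n * (u : ℤ_[p]) ^ 2 → (nkHn ℤ_[p] n).Equivalent Q := by
  induction n with
  | zero =>
    intro V _ _ b Q u _
    have hV : ∀ x : V, x = 0 := by
      intro x; rw [← b.sum_repr x]; simp
    exact nk_equiv_of_maps 0 (fun _ => 0) (fun x => Subsingleton.elim _ _) (fun y => by simp [hV y])
      (fun x => by simp [nkHn_apply])
  | succ n ih =>
    intro V _ _ b Q u hdet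
    have hunit : IsUnit (nkGram Q b).det := by
      rw [hdet]
      exact (IsUnit.pow _ (by simp)).mul (u.isUnit.pow 2)
    have hun := nk_unimod Q b hunit
    have hiso : ∃ e w, Q e = 0 ∧ IsUnit (polar Q e w) := by
      by_cases hn : n = 0
      · subst hn
        refine nk_isotropic_two (V := V) b Q hun u ?_
        have h2 : (nkGram Q b).det = 4 * Q (b 0) * Q (b 1) - polar Q (b 0) (b 1) ^ 2 := by
          rw [show (nkGram Q b).det = _ from Matrix.det_fin_two (nkGram Q b)]
          simp only [nkGram, Matrix.of_apply, polar_self, nsmul_eq_mul, polar_comm Q (b 1) (b 0)]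
          push_cast; ring
        rw [← h2, hdet]; ring
      · exact nk_isotropic_big b Q hun (by simp; omega)
    obtain ⟨e, w, he, v, hv⟩ := hiso
    set f0 := (↑v⁻¹ : ℤ_[p]) • w with hf0
    have hef0 : polar Q e f0 = 1 := by rw [hf0, polar_smul_right, ← hv]; simp
    clear_value f0
    have hpair : NkPair Q e (f0 + (- Q f0) • e) := by
      refine ⟨he, ?_, ?_⟩
      · rw [nk_map_add, QuadraticMap.map_smul, he, polar_smul_right, polar_comm, hef0]; simp
      · rw [polar_add_right, polar_smul_right, nk_polar_self0 he, hef0]; simp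
    set f := f0 + (- Q f0) • e
    have hfree : Module.Free ℤ_[p] V := Module.Free.of_basis b
    have hfin : Module.Finite ℤ_[p] V := Module.Finite.of_basis b
    obtain ⟨g⟩ := nk_split hpair
    let c := Module.finBasis ℤ_[p] (nkPerp Q e f)
    let b' := ((Module.Basis.finTwoProd ℤ_[p]).prod c).map g.toLinearEquiv
    have hd : Module.finrank ℤ_[p] (nkPerp Q e f) = 2 * n := by
      have h1 := Module.finrank_eq_card_basis b
      have h2 := Module.finrank_eq_card_basis b'
      rw [h1] at h2
      simp at h2
      omega
    let c' := c.reindex (finCongr hd)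
    let σ : Fin 2 ⊕ Fin (Module.finrank ℤ_[p] (nkPerp Q e f)) ≃ Fin (2 * (n + 1)) :=
      finSumFinEquiv.trans (finCongr (by omega))
    have hp : ∀ x y, polar Q (g x) (g y) =
        polar ((nkH ℤ_[p]).prod (Q.restrict (nkPerp Q e f))) x y := by
      intro x y
      simp only [polar, ← map_add, g.map_app]
    have hgram : (nkGram Q (b'.reindex σ)).det = - (nkGram (Q.restrict (nkPerp Q e f)) c').det := by
      have e1 : nkGram Q (b'.reindex σ) = (nkGram Q b').submatrix σ.symm σ.symm := by
        ext i j; simp [nkGram]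
      have e2 : nkGram (Q.restrict (nkPerp Q e f)) c' = (nkGram (Q.restrict (nkPerp Q e f)) c).submatrix
          (finCongr hd).symm (finCongr hd).symm := by
        ext i j; simp [nkGram, c']
      rw [e1, e2, Matrix.det_submatrix_equiv_self, Matrix.det_submatrix_equiv_self]
      have e3 : nkGram Q b' = Matrix.fromBlocks !![0, 1; 1, 0] 0 0
          (nkGram (Q.restrict (nkPerp Q e f)) c) := by
        ext i j
        have hb' : ∀ k, b' k = g (((Module.Basis.finTwoProd ℤ_[p]).prod c) k) := by intro k; rfl
        simp only [nkGram, Matrix.of_apply, hb', hp, polar_prod]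
        rcases i with i | i <;> rcases j with j | j
        · fin_cases i <;> fin_cases j <;> simp [polar, nkH_apply]
        · simp
        · simp
        · simp
      rw [e3, Matrix.det_fromBlocks_zero₂₁, Matrix.det_fin_two]
      simp
    obtain ⟨u', hu'⟩ := nk_gram_change Q b (b'.reindex σ)
    have := ih (nkPerp Q e f) c' (Q.restrict (nkPerp Q e f)) (u * u') (by
      rw [hgram, hdet] at hu'
      push_cast
      linear_combination -hu')
    exact (nkHn_succ n).symm.trans (((Equivalent.refl _).prod this).trans ⟨g⟩)

end PartB

section PartC
open Matrix

theorem nk_half {n : Type*} [Fintype n] [LinearOrder n] (S : Matrix n n ℤ) (hs : S.IsSymm)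
    (he : ∀ i, 2 ∣ S i i) : ∃ T : Matrix n n ℤ, S = T + Tᵀ := by
  refine ⟨Matrix.of fun i j => if i < j then S i j else if i = j then S i i / 2 else 0, ?_⟩
  ext i j
  simp only [Matrix.add_apply, Matrix.of_apply, Matrix.transpose_apply]
  rcases lt_trichotomy i j with h | h | h
  · simp [h, not_lt_of_gt h, h.ne']
  · subst h
    have := he i
    simp; omega
  · simp [h, not_lt_of_gt h, h.ne', hs.apply]

theorem nk_castmul {R : Type*} [CommRing R] {l m n : Type*} [Fintype m] (A : Matrix l m ℤ)
    (B : Matrix m n ℤ) : (A * B).map (Int.cast : ℤ → R) =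
      A.map (Int.cast : ℤ → R) * B.map (Int.cast : ℤ → R) :=
  Matrix.map_mul (f := Int.castRingHom R)

theorem nk_formR (L : EvenLattice) (R : Type*) [CommRing R] (x y : Fin L.n → R) :
    formR L R x y = x ⬝ᵥ (L.B.map (Int.cast : ℤ → R) *ᵥ y) := by
  simp only [formR, dotProduct, mulVec, Matrix.map_apply, Finset.mul_sum]
  refine Finset.sum_congr rfl fun i _ => Finset.sum_congr rfl fun j _ => by ring

theorem nk_formR_comm (L : EvenLattice) (R : Type*) [CommRing R] (x y : Fin L.n → R) :
    formR L R x y = formR L R y x := by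
  rw [formR, formR, Finset.sum_comm]
  refine Finset.sum_congr rfl fun i _ => Finset.sum_congr rfl fun j _ => ?_
  rw [L.symm.apply]; ring

theorem nk_formR_add_self (L : EvenLattice) (R : Type*) [CommRing R] (x y : Fin L.n → R) :
    formR L R (x + y) (x + y) = formR L R x x + formR L R y y + 2 * formR L R x y := by
  rw [formR_add_left, nk_formR_comm L R x, nk_formR_comm L R y, formR_add_left, formR_add_left,
    nk_formR_comm L R y x]; ring

theorem nk_even_int (L : EvenLattice) {x : Fin L.n → ℚ} (hx : x ∈ intSub L) :
    ∃ k : ℤ, formR L ℚ x x = 2 * k := by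
  obtain ⟨T, hT⟩ := nk_half L.B L.symm L.even_diag
  choose y hy using hx
  refine ⟨∑ i, ∑ j, T i j * y i * y j, ?_⟩
  have h1 : ∑ i, ∑ j, ((Tᵀ i j : ℤ) : ℚ) * y i * y j = ∑ i, ∑ j, ((T i j : ℤ) : ℚ) * y i * y j := by
    rw [Finset.sum_comm]
    refine Finset.sum_congr rfl fun i _ => Finset.sum_congr rfl fun j _ => ?_
    rw [Matrix.transpose_apply]; ring
  simp only [formR, hy, hT, Matrix.add_apply, Int.cast_add, add_mul, Finset.sum_add_distrib]
  rw [h1]; push_cast; ring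

theorem nk_discQ (L : EvenLattice) (x : dualOf L (intSub L)) :
    discQ L (QuotientAddGroup.mk x) = (QuotientAddGroup.mk (formR L ℚ x x) : Qmod2Z) := by
  have h : (QuotientAddGroup.mk ((QuotientAddGroup.mk x : discGroup L).out) : discGroup L) =
    QuotientAddGroup.mk x := QuotientAddGroup.out_eq' _
  show (QuotientAddGroup.mk _ : Qmod2Z) = _
  rw [QuotientAddGroup.eq]
  rw [QuotientAddGroup.eq] at h
  set y := (QuotientAddGroup.mk x : discGroup L).out
  have h : (-(y : Fin L.n → ℚ) + x) ∈ intSub L := by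
    simpa [AddSubgroup.mem_addSubgroupOf] using h
  obtain ⟨k, hk⟩ := nk_even_int L h
  obtain ⟨m, hm⟩ := y.2 _ h
  have h3 := nk_formR_add_self L ℚ (y : Fin L.n → ℚ) (-(y : Fin L.n → ℚ) + x)
  rw [add_neg_cancel_left, hk, hm] at h3
  refine AddSubgroup.mem_zmultiples_iff.mpr ⟨k + m, ?_⟩
  rw [h3]; push_cast [zsmul_eq_mul]; ring

theorem nk_Qmod2Z {a b : ℚ} (h : (QuotientAddGroup.mk a : Qmod2Z) = QuotientAddGroup.mk b) :
    ∃ k : ℤ, b - a = 2 * k := by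
  rw [QuotientAddGroup.eq] at h
  obtain ⟨k, hk⟩ := AddSubgroup.mem_zmultiples_iff.mp h
  refine ⟨k, ?_⟩
  rw [zsmul_eq_mul] at hk
  linear_combination -hk

theorem nk_data (L M : EvenLattice) (hdisc : FQSIsometric (discQ L) (discQ M)) :
    ∃ (F F' : Matrix (Fin M.n) (Fin L.n) ℤ) (T : Matrix (Fin L.n) (Fin L.n) ℤ),
      M.B * F' = F * L.B ∧ Fᵀ * F' = 1 + (T + Tᵀ) * L.B := by
  obtain ⟨φ, hφ⟩ := hdisc
  set B : Matrix (Fin L.n) (Fin L.n) ℚ := L.B.map (Int.cast : ℤ → ℚ) with hB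
  set C : Matrix (Fin M.n) (Fin M.n) ℚ := M.B.map (Int.cast : ℤ → ℚ) with hC
  have hBdet : IsUnit B.det := by
    have : B.det = ((L.B.det : ℤ) : ℚ) := by
      rw [hB]; exact (RingHom.map_det (Int.castRingHom ℚ) L.B).symm
    rw [this, isUnit_iff_ne_zero]
    exact_mod_cast L.nondeg
  have hBs : Bᵀ = B := by rw [hB, ← Matrix.transpose_map, L.symm]
  have hCs : Cᵀ = C := by rw [hC, ← Matrix.transpose_map, M.symm]
  have hBis : (B⁻¹)ᵀ = B⁻¹ := by rw [Matrix.transpose_nonsing_inv, hBs]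
  -- dual basis
  have hδ : ∀ i, B⁻¹ᵀ i ∈ dualOf L (intSub L) := by
    intro i y hy
    obtain ⟨m, hm⟩ := hy i
    refine ⟨m, ?_⟩
    rw [nk_formR, ← hB, ← hm, Matrix.dotProduct_mulVec, ← Matrix.mulVec_transpose, hBs]
    have : B *ᵥ (B⁻¹ᵀ i) = Pi.single i 1 := by
      have h1 := Matrix.mul_nonsing_inv B hBdet
      ext k
      have := congrFun (congrFun h1 k) i
      rw [Matrix.mul_apply] at this
      simp only [mulVec, dotProduct, Matrix.transpose_apply]
      rw [this, Matrix.one_apply, Pi.single_apply]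
    rw [this]; simp
  let δ : Fin L.n → dualOf L (intSub L) := fun i => ⟨B⁻¹ᵀ i, hδ i⟩
  have hg : ∀ i, ∃ g : dualOf M (intSub M), φ (QuotientAddGroup.mk (δ i)) = QuotientAddGroup.mk g :=
    fun i => ⟨_, (QuotientAddGroup.out_eq' _).symm⟩
  choose g hg using hg
  let G : Matrix (Fin M.n) (Fin L.n) ℚ := Matrix.of fun k i => (g i : Fin M.n → ℚ) k
  have hδδ : ∀ i j, formR L ℚ (δ i) (δ j) = B⁻¹ i j := by
    intro i j
    have : formR L ℚ (δ i) (δ j) = (B⁻¹ᵀ * B * B⁻¹) i j := by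
      rw [nk_formR, ← hB, Matrix.mul_assoc]
      simp only [Matrix.mul_apply, dotProduct, mulVec]
      rfl
    rw [this, hBis, Matrix.nonsing_inv_mul B hBdet, Matrix.one_mul]
  have hgg : ∀ i j, formR M ℚ (g i) (g j) = (Gᵀ * C * G) i j := by
    intro i j
    rw [nk_formR, ← hC, Matrix.mul_assoc]
    simp only [Matrix.mul_apply, dotProduct, mulVec]
    rfl
  -- F
  have hF : ∀ k i, ∃ m : ℤ, (C * G) k i = m := by
    intro k i
    obtain ⟨m, hm⟩ := (g i).2 (Pi.single k 1) (by
      intro j; exact ⟨if j = k then 1 else 0, by simp [Pi.single_apply]⟩)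
    refine ⟨m, ?_⟩
    rw [← hm, nk_formR_comm, nk_formR, ← hC]
    rw [single_one_dotProduct]
    simp [mulVec, dotProduct, Matrix.mul_apply, G]
  choose F hF using hF
  have hF' : ∀ k j, ∃ m : ℤ, (G * B) k j = m := by
    intro k j
    have h1 : (∑ i, L.B i j • (QuotientAddGroup.mk (δ i) : discGroup L)) = 0 := by
      have : (∑ i, L.B i j • (QuotientAddGroup.mk (δ i) : discGroup L)) =
          QuotientAddGroup.mk (∑ i, L.B i j • δ i) := by
        rw [← QuotientAddGroup.mk'_apply, map_sum]
        simp
      rw [this, QuotientAddGroup.eq_zero_iff, AddSubgroup.mem_addSubgroupOf]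
      intro k
      refine ⟨if k = j then 1 else 0, ?_⟩
      have h2 := congrFun (congrFun (Matrix.nonsing_inv_mul B hBdet) k) j
      rw [Matrix.mul_apply, Matrix.one_apply] at h2
      have h3 : ((∑ i, L.B i j • δ i : dualOf L (intSub L)) : Fin L.n → ℚ) k =
          ∑ i, B⁻¹ k i * B i j := by
        simp [δ, Finset.sum_apply, hB, mul_comm]
      rw [h3, h2]; push_cast; rfl
    have h4 : (∑ i, L.B i j • (QuotientAddGroup.mk (g i) : discGroup M)) = 0 := by
      have := congrArg φ h1
      rw [map_sum, map_zero] at this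
      rw [← this]
      refine Finset.sum_congr rfl fun i _ => ?_
      rw [map_zsmul, hg]
    have h5 : (∑ i, L.B i j • (QuotientAddGroup.mk (g i) : discGroup M)) =
          QuotientAddGroup.mk (∑ i, L.B i j • g i) := by
      rw [← QuotientAddGroup.mk'_apply, map_sum]
      simp
    rw [h5, QuotientAddGroup.eq_zero_iff, AddSubgroup.mem_addSubgroupOf] at h4
    obtain ⟨m, hm⟩ := h4 k
    refine ⟨m, ?_⟩
    rw [← hm]
    simp [Matrix.mul_apply, G, Finset.sum_apply, hB, mul_comm]
  choose F' hF' using hF'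
  have hq : ∀ (x : dualOf L (intSub L)) (y : dualOf M (intSub M)),
      φ (QuotientAddGroup.mk x) = QuotientAddGroup.mk y →
      ∃ k : ℤ, formR M ℚ y y - formR L ℚ x x = 2 * k := by
    intro x y h
    have := hφ (QuotientAddGroup.mk x)
    rw [h, nk_discQ, nk_discQ] at this
    exact nk_Qmod2Z this.symm
  have hdiag : ∀ i, ∃ k : ℤ, (Gᵀ * C * G - B⁻¹) i i = 2 * k := by
    intro i
    obtain ⟨k, hk⟩ := hq _ _ (hg i)
    exact ⟨k, by rw [← hk, hgg, hδδ, Matrix.sub_apply]⟩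
  have hS : ∀ i j, ∃ k : ℤ, (Gᵀ * C * G - B⁻¹) i j = k := by
    intro i j
    obtain ⟨k, hk⟩ := hq (δ i + δ j) (g i + g j) (by
      rw [QuotientAddGroup.mk_add, map_add, hg, hg, QuotientAddGroup.mk_add])
    obtain ⟨k1, hk1⟩ := hdiag i
    obtain ⟨k2, hk2⟩ := hdiag j
    rw [AddSubgroup.coe_add, AddSubgroup.coe_add, nk_formR_add_self, nk_formR_add_self, hgg, hgg,
      hgg, hδδ, hδδ, hδδ] at hk
    rw [Matrix.sub_apply] at hk1 hk2 ⊢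
    refine ⟨k - k1 - k2, ?_⟩
    push_cast
    linear_combination (hk - hk1 - hk2) / 2
  choose S hS using hS
  have hSQ : (Matrix.of S).map (Int.cast : ℤ → ℚ) = Gᵀ * C * G - B⁻¹ := by
    ext i j; simp only [Matrix.map_apply, Matrix.of_apply]; rw [hS]
  have hSs : (Matrix.of S).IsSymm := by
    apply Matrix.map_injective (Int.cast_injective (α := ℚ))
    beta_reduce
    rw [Matrix.transpose_map, hSQ, Matrix.transpose_sub, hBis, Matrix.transpose_mul,
      Matrix.transpose_mul, Matrix.transpose_transpose, hCs, Matrix.mul_assoc]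
  obtain ⟨T, hT⟩ := nk_half (Matrix.of S) hSs (by
    intro i
    obtain ⟨k, hk⟩ := hdiag i
    rw [hS] at hk
    exact ⟨k, by exact_mod_cast hk⟩)
  have hFQ : (Matrix.of F).map (Int.cast : ℤ → ℚ) = C * G := by
    ext i j; simp only [Matrix.map_apply, Matrix.of_apply]; rw [hF]
  have hFQ' : (Matrix.of F').map (Int.cast : ℤ → ℚ) = G * B := by
    ext i j; simp only [Matrix.map_apply, Matrix.of_apply]; rw [hF']
  refine ⟨Matrix.of F, Matrix.of F', T, ?_, ?_⟩
  · apply Matrix.map_injective (Int.cast_injective (α := ℚ))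
    beta_reduce
    rw [nk_castmul, nk_castmul, hFQ, hFQ', ← hB, ← hC, Matrix.mul_assoc]
  · apply Matrix.map_injective (Int.cast_injective (α := ℚ))
    beta_reduce
    rw [← hT]
    rw [Matrix.map_add _ Int.cast_add, nk_castmul, nk_castmul, Matrix.transpose_map, hFQ, hFQ',
      hSQ, ← hB, Matrix.transpose_mul, hCs, Matrix.sub_mul, Matrix.nonsing_inv_mul B hBdet,
      Matrix.map_one _ (by simp) (by simp)]
    simp only [Matrix.mul_assoc]
    abel

end PartC

section PartD
open Matrix

theorem nk_det {R : Type*} [CommRing R] {n m : Type*} [Fintype n] [Fintype m] [DecidableEq n]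
    [DecidableEq m] (B S : Matrix n n R) (C : Matrix m m R) (F F' : Matrix m n R)
    (h1 : C * F' = F * B) (h2 : Fᵀ * F' = 1 + S * B) :
    (fromBlocks S Fᵀ F C).det * B.det = (-1) ^ Fintype.card n * C.det := by
  have h : fromBlocks S Fᵀ F C * fromBlocks B 0 (-F') 1 = fromBlocks (-1) Fᵀ 0 C := by
    rw [fromBlocks_multiply]
    simp [h1, h2]
  have := congrArg Matrix.det h
  rw [det_mul, det_fromBlocks_zero₁₂, det_fromBlocks_zero₂₁, det_one, mul_one, det_neg,
    det_one, mul_one] at this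
  exact this

/-- quadratic form of a matrix -/
def nkq {R : Type*} [CommRing R] {n : Type*} [Fintype n] [DecidableEq n] (A : Matrix n n R) :
    QuadraticForm R (n → R) :=
  LinearMap.BilinMap.toQuadraticMap (Matrix.toLinearMap₂' R A)

theorem nkq_apply {R : Type*} [CommRing R] {n : Type*} [Fintype n] [DecidableEq n]
    (A : Matrix n n R) (x : n → R) : nkq A x = x ⬝ᵥ A *ᵥ x := by
  simp [nkq, Matrix.toLinearMap₂'_apply']

theorem nk_dot_swap {R : Type*} [CommRing R] {n m : Type*} [Fintype n] [Fintype m]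
    (A : Matrix n m R) (x : n → R) (y : m → R) : x ⬝ᵥ A *ᵥ y = y ⬝ᵥ Aᵀ *ᵥ x := by
  rw [dotProduct_mulVec, mulVec_transpose, dotProduct_comm]

theorem nkq_polar {R : Type*} [CommRing R] {n : Type*} [Fintype n] [DecidableEq n]
    (A : Matrix n n R) (x y : n → R) : polar (nkq A) x y = x ⬝ᵥ (A + Aᵀ) *ᵥ y := by
  simp only [polar, nkq_apply, mulVec_add, add_dotProduct, dotProduct_add, add_mulVec]
  rw [nk_dot_swap A y x]; ring

theorem nk_stable {R : Type*} [CommRing R] [IsDomain R] [CharZero R] {n : ℕ} {m : Type*} [Fintype m]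
    [DecidableEq m] (B T TB : Matrix (Fin n) (Fin n) R) (C TC : Matrix m m R)
    (F F' : Matrix m (Fin n) R) (hB : B = TB + TBᵀ) (hC : C = TC + TCᵀ)
    (h1 : C * F' = F * B) (h2 : Fᵀ * F' = 1 + (T + Tᵀ) * B) :
    ((nkHn R n).prod (nkq TC)).Equivalent
      ((nkq (fromBlocks T 0 F TC)).prod (nkq TB)) := by
  let a : (Fin n → R × R) × (m → R) → Fin n → R := fun v =>
    (fun i => (v.1 i).1) - T *ᵥ (fun i => (v.1 i).2) + Fᵀ *ᵥ v.2
  have ha1 : ∀ v w, a (v + w) = a v + a w := by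
    intro v w
    have e1 : (fun i => ((v + w).1 i).1) = (fun i => (v.1 i).1) + fun i => (w.1 i).1 := rfl
    have e2 : (fun i => ((v + w).1 i).2) = (fun i => (v.1 i).2) + fun i => (w.1 i).2 := rfl
    simp only [a]
    rw [e1, e2, Prod.snd_add, mulVec_add, mulVec_add]; abel
  have ha2 : ∀ (c : R) v, a (c • v) = c • a v := by
    intro c v
    have e1 : (fun i => ((c • v).1 i).1) = c • (fun i => (v.1 i).1) := rfl
    have e2 : (fun i => ((c • v).1 i).2) = c • (fun i => (v.1 i).2) := rfl
    simp only [a]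
    rw [e1, e2, Prod.smul_snd, mulVec_smul, mulVec_smul, smul_add, smul_sub]
  refine nk_equiv_of_maps
    { toFun := fun v => (Sum.elim (-(fun i => (v.1 i).2) + B *ᵥ a v) (v.2 - F' *ᵥ a v), a v)
      map_add' := ?_
      map_smul' := ?_ }
    (fun y => (fun i =>
      ((y.2 + T *ᵥ (B *ᵥ y.2 - y.1 ∘ Sum.inl) - Fᵀ *ᵥ (y.1 ∘ Sum.inr + F' *ᵥ y.2)) i,
        (B *ᵥ y.2 - y.1 ∘ Sum.inl) i), y.1 ∘ Sum.inr + F' *ᵥ y.2)) ?_ ?_ ?_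
  · intro v w
    rw [ha1]
    refine Prod.ext ?_ rfl
    funext i
    rcases i with i | i
    · simp [mulVec_add]; ring
    · simp [mulVec_add]; ring
  · intro c v
    rw [ha2]
    refine Prod.ext ?_ rfl
    funext i
    rcases i with i | i
    · simp [mulVec_smul]; ring
    · simp [mulVec_smul]; ring
  · intro v
    have e0 : B *ᵥ a v - (-(fun i => (v.1 i).2) + B *ᵥ a v) = fun i => (v.1 i).2 := by abel
    simp only [LinearMap.coe_mk, AddHom.coe_mk, Sum.elim_comp_inl, Sum.elim_comp_inr,
      sub_add_cancel, e0]
    refine Prod.ext ?_ rfl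
    funext i
    refine Prod.ext ?_ rfl
    simp [a]; ring
  · intro y
    have e0 : a (fun i =>
      ((y.2 + T *ᵥ (B *ᵥ y.2 - y.1 ∘ Sum.inl) - Fᵀ *ᵥ (y.1 ∘ Sum.inr + F' *ᵥ y.2)) i,
        (B *ᵥ y.2 - y.1 ∘ Sum.inl) i), y.1 ∘ Sum.inr + F' *ᵥ y.2) = y.2 := by
      funext i
      simp only [a, Pi.add_apply, Pi.sub_apply]
      have : (fun i => (B *ᵥ y.2) i - (y.1 ∘ Sum.inl) i) = B *ᵥ y.2 - y.1 ∘ Sum.inl := rfl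
      rw [this]; ring
    simp only [LinearMap.coe_mk, AddHom.coe_mk, e0]
    refine Prod.ext ?_ rfl
    funext i
    rcases i with i | i
    · simp
    · simp
  · intro v
    have hu : (fun i => (v.1 i).1) = a v + T *ᵥ (fun i => (v.1 i).2) - Fᵀ *ᵥ v.2 := by
      simp only [a]; abel
    have hh : nkHn R n v.1 = (fun i => (v.1 i).1) ⬝ᵥ (fun i => (v.1 i).2) := by
      rw [nkHn_apply]; rfl
    simp only [LinearMap.coe_mk, AddHom.coe_mk, QuadraticMap.prod_apply]
    rw [hh, hu]
    generalize (fun i => (v.1 i).2) = t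
    generalize v.2 = z
    generalize a v = w
    have k1 : C *ᵥ (F' *ᵥ w) = F *ᵥ (B *ᵥ w) := by rw [mulVec_mulVec, h1, mulVec_mulVec]
    have k2 : Fᵀ *ᵥ (F' *ᵥ w) = w + (T + Tᵀ) *ᵥ (B *ᵥ w) := by
      rw [mulVec_mulVec, h2, mulVec_mulVec, add_mulVec, one_mulVec]
    have k3 : B *ᵥ w ⬝ᵥ w = 2 * (w ⬝ᵥ TB *ᵥ w) := by
      rw [dotProduct_comm, hB, add_mulVec, dotProduct_add, ← nk_dot_swap TB]; ring
    generalize B *ᵥ w = y at *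
    generalize F' *ᵥ w = x at *
    rw [nkq_apply, nkq_apply, nkq_apply, fromBlocks_mulVec, sumElim_dotProduct_sumElim]
    simp only [Sum.elim_comp_inl, Sum.elim_comp_inr, zero_mulVec, add_zero, mulVec_add, mulVec_sub,
      mulVec_neg, dotProduct_add, dotProduct_sub, dotProduct_neg, add_dotProduct, sub_dotProduct,
      neg_dotProduct]
    have q1 := dotProduct_comm (T *ᵥ t) t
    have q2 : Fᵀ *ᵥ z ⬝ᵥ t = z ⬝ᵥ F *ᵥ t := by rw [dotProduct_comm, ← nk_dot_swap]
    have q3 : ∀ s, x ⬝ᵥ F *ᵥ s = s ⬝ᵥ w + s ⬝ᵥ T *ᵥ y + y ⬝ᵥ T *ᵥ s := by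
      intro s
      rw [nk_dot_swap F, k2, add_mulVec, dotProduct_add, dotProduct_add, ← nk_dot_swap T y s]; ring
    have q4 : ∀ s, s ⬝ᵥ F *ᵥ y = s ⬝ᵥ TC *ᵥ x + x ⬝ᵥ TC *ᵥ s := by
      intro s
      rw [← k1, hC, add_mulVec, dotProduct_add, ← nk_dot_swap TC x s]
    have q5 := q3 t
    have q6 := q4 z
    have q7 := q3 y
    have q8 := q4 x
    have q9 := dotProduct_comm w t
    have q10 : y ⬝ᵥ T *ᵥ y - x ⬝ᵥ F *ᵥ y + x ⬝ᵥ TC *ᵥ x + w ⬝ᵥ TB *ᵥ w = 0 := by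
      have h2 : (2 : R) ≠ 0 := two_ne_zero
      apply mul_left_cancel₀ h2
      linear_combination -q7 - q8 - k3
    linear_combination q10 + q5 + q6 - q1 + q2 - q9

end PartD

section PartE
open Matrix

theorem nk_equiv_prod {R V V' W : Type*} [CommRing R] [AddCommGroup V] [Module R V]
    [AddCommGroup V'] [Module R V'] [AddCommGroup W] [Module R W] {Q : QuadraticForm R V}
    {Q' : QuadraticForm R V'} (P : QuadraticForm R W) (h : Q.Equivalent Q') :
    (Q.prod P).Equivalent (Q'.prod P) := by
  obtain ⟨e⟩ := h
  exact ⟨IsometryEquiv.prod e (QuadraticMap.IsometryEquiv.refl P)⟩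

theorem nk_det_cast {R : Type*} [CommRing R] {n : Type*} [Fintype n] [DecidableEq n]
    (A : Matrix n n ℤ) : (A.map (Int.cast : ℤ → R)).det = (A.det : R) :=
  (RingHom.map_det (Int.castRingHom R) A).symm

theorem nk_padic (p : ℕ) [Fact p.Prime] (L M : EvenLattice) (hn : L.n = M.n)
    (hdet : L.B.det = M.B.det) (hdisc : FQSIsometric (discQ L) (discQ M)) :
    IsometricOver ℤ_[p] L M := by
  obtain ⟨F, F', T, h1, h2⟩ := nk_data L M hdisc
  obtain ⟨TB, hTB⟩ := nk_half L.B L.symm L.even_diag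
  obtain ⟨TC, hTC⟩ := nk_half M.B M.symm M.even_diag
  let c : ∀ {a b : ℕ}, Matrix (Fin a) (Fin b) ℤ → Matrix (Fin a) (Fin b) ℤ_[p] :=
    fun A => A.map (Int.cast : ℤ → ℤ_[p])
  have cadd : ∀ {a b : ℕ} (A A' : Matrix (Fin a) (Fin b) ℤ), c (A + A') = c A + c A' :=
    fun A A' => Matrix.map_add _ Int.cast_add A A'
  have ct : ∀ {a b : ℕ} (A : Matrix (Fin a) (Fin b) ℤ), c Aᵀ = (c A)ᵀ := fun A => rfl
  have cmul : ∀ {a b d : ℕ} (A : Matrix (Fin a) (Fin b) ℤ) (A' : Matrix (Fin b) (Fin d) ℤ),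
    c (A * A') = c A * c A' := fun A A' => nk_castmul A A'
  have cone : ∀ {a : ℕ}, c (1 : Matrix (Fin a) (Fin a) ℤ) = 1 :=
    Matrix.map_one _ Int.cast_zero Int.cast_one
  have g1 : c M.B * c F' = c F * c L.B := by rw [← cmul, h1, cmul]
  have g2 : (c F)ᵀ * c F' = 1 + (c T + (c T)ᵀ) * c L.B := by
    rw [← ct, ← cmul, h2, cadd, cmul, cadd, cone, ct]
  have gB : c L.B = c TB + (c TB)ᵀ := by rw [← ct, ← cadd, ← hTB]
  have gC : c M.B = c TC + (c TC)ᵀ := by rw [← ct, ← cadd, ← hTC]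
  have st := nk_stable (c L.B) (c T) (c TB) (c M.B) (c TC) (c F) (c F') gB gC g1 g2
  have hd : (fromBlocks (c T + (c T)ᵀ) (c F)ᵀ (c F) (c M.B)).det = (-1) ^ L.n := by
    have := nk_det (c L.B) (c T + (c T)ᵀ) (c M.B) (c F) (c F') g1 g2
    have e1 : (c L.B).det = (c M.B).det := by
      rw [nk_det_cast, nk_det_cast, hdet]
    have e2 : (c M.B).det ≠ 0 := by
      rw [nk_det_cast]; exact_mod_cast M.nondeg
    rw [e1, Fintype.card_fin] at this
    exact mul_right_cancel₀ e2 this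
  let ee : Fin L.n ⊕ Fin M.n ≃ Fin (2 * L.n) :=
    finSumFinEquiv.trans (finCongr (by omega))
  have hy : (nkHn ℤ_[p] L.n).Equivalent (nkq (fromBlocks (c T) 0 (c F) (c TC))) := by
    refine nk_hyperbolic L.n _ ((Pi.basisFun ℤ_[p] _).reindex ee) _ 1 ?_
    have : nkGram (nkq (fromBlocks (c T) 0 (c F) (c TC))) ((Pi.basisFun ℤ_[p] _).reindex ee) =
        (fromBlocks (c T + (c T)ᵀ) (c F)ᵀ (c F) (c M.B)).submatrix ee.symm ee.symm := by
      ext i j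
      rw [nkGram, Matrix.of_apply, nkq_polar, fromBlocks_transpose, fromBlocks_add, ← gC,
        Matrix.transpose_zero, zero_add, add_zero, Module.Basis.reindex_apply,
        Module.Basis.reindex_apply, Pi.basisFun_apply, Pi.basisFun_apply, single_one_dotProduct,
        mulVec_single_one]
      rfl
    rw [this, det_submatrix_equiv_self, hd]; simp
  obtain ⟨e⟩ := nk_cancel_n L.n ((st.trans (nk_equiv_prod _ hy.symm)))
  refine ⟨e.symm.toLinearEquiv, fun x y => ?_⟩
  have e1 : ∀ x y, formR L ℤ_[p] x y = polar (nkq (c TB)) x y := by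
    intro x y; rw [nk_formR, nkq_polar, ← gB]
  have e2 : ∀ x y, formR M ℤ_[p] x y = polar (nkq (c TC)) x y := by
    intro x y; rw [nk_formR, nkq_polar, ← gC]
  rw [e1, e2]
  have e3 : ∀ x, nkq (c TC) (e.symm.toLinearEquiv x) = nkq (c TB) x := e.symm.map_app
  simp only [polar, ← map_add, e3]

theorem nk_absdet (L M : EvenLattice) (hdisc : FQSIsometric (discQ L) (discQ M)) :
    L.B.det ∣ M.B.det := by
  obtain ⟨F, F', T, h1, h2⟩ := nk_data L M hdisc
  have := nk_det _ _ _ _ _ h1 h2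
  refine ((Int.isUnit_iff.mpr ?_ : IsUnit ((-1 : ℤ) ^ Fintype.card (Fin L.n))).dvd_mul_left).mp
    ⟨_, by rw [← this, mul_comm]⟩
  exact neg_one_pow_eq_or ℤ _

theorem nk_det_eq (L M : EvenLattice) (hdisc : FQSIsometric (discQ L) (discQ M))
    (hs : 0 < L.B.det * M.B.det) : L.B.det = M.B.det := by
  have h1 := nk_absdet L M hdisc
  have h2 : M.B.det ∣ L.B.det := by
    obtain ⟨e, he⟩ := hdisc
    exact nk_absdet M L ⟨e.symm, fun x => by rw [← he, AddEquiv.apply_symm_apply]⟩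
  rcases Int.associated_iff.mp (associated_of_dvd_dvd h1 h2) with h | h
  · exact h
  · rw [h] at hs; nlinarith [mul_self_nonneg M.B.det]

end PartE

section PartF
open Matrix

/-- the real quadratic form of a lattice -/
def nkReal (L : EvenLattice) : QuadraticForm ℝ (Fin L.n → ℝ) :=
  nkq (L.B.map (Int.cast : ℤ → ℝ))

theorem nkReal_apply (L : EvenLattice) (x : Fin L.n → ℝ) : nkReal L x = formR L ℝ x x := by
  rw [nkReal, nkq_apply, nk_formR]

theorem nkReal_polar (L : EvenLattice) (x y : Fin L.n → ℝ) :
    polar (nkReal L) x y = 2 * formR L ℝ x y := by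
  simp only [polar, nkReal_apply, nk_formR_add_self]; ring

theorem nk_sigPlus (L : EvenLattice) : sigPlus L = sigPos (nkReal L) := by
  rw [sigPlus]
  refine Eq.trans ?_ (sigPos_isGreatest (nkReal L)).csSup_eq
  congr 1
  ext d
  simp only [Set.mem_setOf_eq]
  refine exists_congr fun W => and_congr_right fun _ => ?_
  constructor
  · rintro h ⟨x, hx⟩ hx0
    have := h x hx (fun h => hx0 (by ext1; exact h))
    simpa [nkReal_apply] using this
  · intro h x hx hx0
    have := h ⟨x, hx⟩ (fun h => hx0 (congrArg Subtype.val h))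
    simpa [nkReal_apply] using this

theorem nk_sigMinus (L : EvenLattice) : sigMinus L = sigNeg (nkReal L) := by
  rw [sigMinus]
  refine Eq.trans ?_ (sigNeg_isGreatest (nkReal L)).csSup_eq
  congr 1
  ext d
  simp only [Set.mem_setOf_eq]
  refine exists_congr fun W => and_congr_right fun _ => ?_
  constructor
  · rintro h ⟨x, hx⟩ hx0
    have := h x hx (fun h => hx0 (by ext1; exact h))
    simpa [nkReal_apply] using this
  · intro h x hx hx0
    have := h ⟨x, hx⟩ (fun h => hx0 (congrArg Subtype.val h))
    simpa [nkReal_apply] using this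

theorem nk_sep (L : EvenLattice) : (associated (R := ℝ) (nkReal L)).SeparatingLeft := by
  intro x hx
  have h1 : ∀ y, formR L ℝ x y = 0 := by
    intro y
    have h2 := two_nsmul_associated ℝ (nkReal L)
    have h3 : 2 • (associated (R := ℝ) (nkReal L) x y) = polar (nkReal L) x y := by
      rw [← polarBilin_apply_apply, ← h2]; rfl
    rw [nkReal_polar, hx] at h3
    linarith [h3, smul_zero (A := ℝ) (2 : ℕ)]
  by_contra hx0
  have hd : (L.B.map (Int.cast : ℤ → ℝ)).det ≠ 0 := by
    rw [nk_det_cast]; exact_mod_cast L.nondeg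
  refine hd (exists_mulVec_eq_zero_iff.mp ⟨x, hx0, ?_⟩)
  funext i
  have := h1 (Pi.single i 1)
  rw [nk_formR_comm, nk_formR, single_one_dotProduct] at this
  exact this

theorem nk_perm {ι κ : Type*} [Finite ι] [Finite κ] (w : ι → ℝ) (v : κ → ℝ)
    (hw : ∀ i, w i = -1 ∨ w i = 1) (hv : ∀ i, v i = -1 ∨ v i = 1)
    (h1 : {i | 0 < w i}.ncard = {i | 0 < v i}.ncard)
    (h2 : {i | w i < 0}.ncard = {i | v i < 0}.ncard) :
    ∃ σ : ι ≃ κ, ∀ i, v (σ i) = w i := by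
  have key : ∀ c : ℝ, Nonempty ({i // w i = c} ≃ {i // v i = c}) := by
    intro c
    by_cases hc1 : c = 1
    · subst hc1
      have e1 : {i | 0 < w i} = {i | w i = 1} := by
        ext i; rcases hw i with h | h <;> simp [h]; norm_num
      have e2 : {i | 0 < v i} = {i | v i = 1} := by
        ext i; rcases hv i with h | h <;> simp [h]; norm_num
      rw [e1, e2] at h1
      exact (Finite.card_eq (α := {i // w i = 1}) (β := {i // v i = 1})).mp h1
    by_cases hc2 : c = -1
    · subst hc2
      have e1 : {i | w i < 0} = {i | w i = -1} := by
        ext i; rcases hw i with h | h <;> simp [h]; norm_num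
      have e2 : {i | v i < 0} = {i | v i = -1} := by
        ext i; rcases hv i with h | h <;> simp [h]; norm_num
      rw [e1, e2] at h2
      exact (Finite.card_eq (α := {i // w i = -1}) (β := {i // v i = -1})).mp h2
    have : IsEmpty {i // w i = c} := ⟨fun ⟨i, hi⟩ => by rcases hw i with h | h <;> simp_all⟩
    have : IsEmpty {i // v i = c} := ⟨fun ⟨i, hi⟩ => by rcases hv i with h | h <;> simp_all⟩
    exact ⟨Equiv.equivOfIsEmpty _ _⟩
  exact ⟨Equiv.ofFiberEquiv fun c => (key c).some, fun i => Equiv.ofFiberEquiv_map _ i⟩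

theorem nk_real (L M : EvenLattice) (hplus : sigPlus L = sigPlus M)
    (hminus : sigMinus L = sigMinus M) : IsometricOver ℝ L M := by
  obtain ⟨w, hw, hL⟩ := QuadraticForm.equivalent_one_neg_one_weighted_sum_squared _ (nk_sep L)
  obtain ⟨v, hv, hM⟩ := QuadraticForm.equivalent_one_neg_one_weighted_sum_squared _ (nk_sep M)
  rw [nk_sigPlus, nk_sigPlus, QuadraticForm.sigPos_of_equiv_weightedSumSquares hL,
    QuadraticForm.sigPos_of_equiv_weightedSumSquares hM] at hplus
  rw [nk_sigMinus, nk_sigMinus, QuadraticForm.sigNeg_of_equiv_weightedSumSquares hL,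
    QuadraticForm.sigNeg_of_equiv_weightedSumSquares hM] at hminus
  obtain ⟨σ, hσ⟩ := nk_perm w v hw hv hplus hminus
  have hE : (weightedSumSquares ℝ w).Equivalent (weightedSumSquares ℝ v) := by
    refine ⟨⟨LinearEquiv.funCongrLeft ℝ ℝ σ.symm, fun x => ?_⟩⟩
    simp only [AddHom.toFun_eq_coe, LinearMap.coe_toAddHom, LinearEquiv.coe_coe,
      weightedSumSquares_apply, LinearEquiv.funCongrLeft_apply, LinearMap.funLeft_apply]
    rw [← Equiv.sum_comp σ]
    simp [hσ]
  obtain ⟨e⟩ := (hL.trans hE).trans hM.symm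
  refine ⟨e.toLinearEquiv, fun x y => ?_⟩
  have h : 2 * formR M ℝ (e.toLinearEquiv x) (e.toLinearEquiv y) = 2 * formR L ℝ x y := by
    rw [← nkReal_polar, ← nkReal_polar]
    have e3 : ∀ x, nkReal M (e.toLinearEquiv x) = nkReal L x := e.map_app
    simp only [polar, ← map_add, e3]
  linarith

theorem nk_sign (L M : EvenLattice) (h : IsometricOver ℝ L M) :
    L.n = M.n ∧ 0 < L.B.det * M.B.det := by
  obtain ⟨e, he⟩ := h
  have hn : L.n = M.n := by simpa using e.finrank_eq
  refine ⟨hn, ?_⟩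
  let P : Matrix (Fin M.n) (Fin M.n) ℝ :=
    Matrix.of fun i j => e (Pi.single ((finCongr hn).symm j) 1) i
  have h1 : Pᵀ * (M.B.map (Int.cast : ℤ → ℝ)) * P =
      (L.B.map (Int.cast : ℤ → ℝ)).submatrix (finCongr hn).symm (finCongr hn).symm := by
    ext i j
    have := he (Pi.single ((finCongr hn).symm i) 1) (Pi.single ((finCongr hn).symm j) 1)
    rw [nk_formR, nk_formR, single_one_dotProduct, mulVec_single_one] at this
    rw [submatrix_apply]
    refine Eq.trans ?_ this
    rw [Matrix.mul_assoc]
    simp only [Matrix.mul_apply, dotProduct, mulVec]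
    rfl
  have h2 := congrArg Matrix.det h1
  rw [det_submatrix_equiv_self, det_mul, det_mul, det_transpose, nk_det_cast, nk_det_cast] at h2
  have hL : (L.B.det : ℝ) ≠ 0 := by exact_mod_cast L.nondeg
  have hM : (M.B.det : ℝ) ≠ 0 := by exact_mod_cast M.nondeg
  have hP : P.det ≠ 0 := by
    intro h; rw [h] at h2; apply hL; rw [← h2]; ring
  have : (0 : ℝ) < L.B.det * M.B.det := by
    rw [← h2]
    have : 0 < (P.det * M.B.det) ^ 2 := by positivity
    nlinarith
  exact_mod_cast this

theorem nk_main (L M : EvenLattice)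
    (hdisc : FQSIsometric (discQ L) (discQ M))
    (hplus : sigPlus L = sigPlus M) (hminus : sigMinus L = sigMinus M) :
    SameGenus L M := by
  have hr := nk_real L M hplus hminus
  obtain ⟨hn, hs⟩ := nk_sign L M hr
  exact ⟨fun p _ => nk_padic p L M hn (nk_det_eq L M hdisc hs) hdisc, hr⟩

end PartF

end NkAll

/-- **Nikulin: the discriminant form and signature determine the genus.**
If two even lattices have isometric discriminant forms and equal signatures,
then they lie in the same genus. -/
theorem genus_determined_by_discriminant_form_and_signature
    (L M : EvenLattice)
    (hdisc : FQSIsometric (discQ L) (discQ M))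
    (hplus : sigPlus L = sigPlus M) (hminus : sigMinus L = sigMinus M) :
    SameGenus L M := by
  exact nk_main L M hdisc hplus hminus
end
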